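/- Let s < q−1 and let X be the curve cut out on the elliptic quadric E ⊂ P³ over F_q by a surface of degree s not containing E. Then the number of F_q-rational points of X is at most s(q+1). -/

import Mathlib

namespace EllipticQuadric

open MvPolynomial

section Homogeneous

variable {F R : Type*} [Field F] [CommRing R] [Algebra F R]

theorem aeval_mul_of_isHomogeneous {σ : Type*} {s : ℕ} {f : MvPolynomial σ F}
    (hf : f.IsHomogeneous s) (c : R) (x : σ → R) :
    aeval (fun i => c * x i) f = c ^ s * aeval x f := by
  rw [aeval_def, aeval_def, eval₂_eq, eval₂_eq, Finset.mul_sum]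
  refine Finset.sum_congr rfl fun m hm => ?_
  rw [hf.degree_eq_sum_deg_support hm]
  simp only [mul_pow, Finset.prod_mul_distrib, Finset.prod_pow_eq_pow_sum]
  ring

end Homogeneous

/-- A form vanishing at all points `(1, u, v, Q(u,v))` over an infinite extension field is a
multiple of the equation of the quadric. -/
theorem mem_span_of_aeval_eq_zero {F K : Type*} [Field F] [Field K] [Infinite K] [Algebra F K]
    (t n : F) {s : ℕ} {f : MvPolynomial (Fin 4) F} (hf : f.IsHomogeneous s)
    (h : ∀ u v : K, aeval
      ![1, u, v, u ^ 2 + algebraMap F K t * u * v + algebraMap F K n * v ^ 2] f = 0) :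
    f ∈ Ideal.span {(X 0 * X 3 -
      (X 1 ^ 2 + C t * X 1 * X 2 + C n * X 2 ^ 2) : MvPolynomial (Fin 4) F)} := by
  set e : MvPolynomial (Fin 4) F := X 0 * X 3 - (X 1 ^ 2 + C t * X 1 * X 2 + C n * X 2 ^ 2)
    with he
  let y : Fin 4 → MvPolynomial (Fin 4) F :=
    ![X 0 * X 0, X 0 * X 1, X 0 * X 2, X 1 ^ 2 + C t * X 1 * X 2 + C n * X 2 ^ 2]
  have hy : X 0 * aeval y f = 0 := by
    apply map_injective _ (algebraMap F K).injective
    rw [map_zero]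
    refine MvPolynomial.funext fun p => ?_
    rw [eval_map, ← aeval_def, map_zero, map_mul, aeval_X, comp_aeval_apply]
    by_cases hp : p 0 = 0
    · rw [hp, zero_mul]
    · have hpt : (fun i => aeval p (y i)) = fun i => (p 0 ^ 2) * ![1, p 1 / p 0, p 2 / p 0,
          (p 1 / p 0) ^ 2 + algebraMap F K t * (p 1 / p 0) * (p 2 / p 0) +
            algebraMap F K n * (p 2 / p 0) ^ 2] i := by
        funext i
        fin_cases i <;> simp [y] <;> field_simp
      rw [hpt, aeval_mul_of_isHomogeneous hf, h, mul_zero, mul_zero]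
  have hy0 : aeval y f = 0 := (mul_eq_zero.mp hy).resolve_left (X_ne_zero 0)
  have hdvd : e ∣ X 0 ^ s * f := by
    rw [← Ideal.mem_span_singleton, ← Ideal.Quotient.eq_zero_iff_mem]
    have hX := aeval_mul_of_isHomogeneous hf (X 0 : MvPolynomial (Fin 4) F) X
    rw [aeval_X_left_apply] at hX
    rw [← hX, ← Ideal.Quotient.mkₐ_eq_mk F, comp_aeval_apply]
    have hpt : (fun i => Ideal.Quotient.mkₐ F (Ideal.span {e}) (X 0 * X i)) =
        fun i => Ideal.Quotient.mkₐ F (Ideal.span {e}) (y i) := by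
      funext i
      fin_cases i
      · rfl
      · rfl
      · rfl
      · exact Ideal.Quotient.eq.mpr (Ideal.mem_span_singleton_self e)
    rw [hpt, ← comp_aeval_apply, hy0, map_zero]
  obtain ⟨c, hc⟩ := hdvd
  have hX0 : ¬ (X 0 : MvPolynomial (Fin 4) F) ∣ e := by
    rintro ⟨d, hd⟩
    simpa [he] using congrArg (eval ![0, 1, 0, 0]) hd
  obtain ⟨d, rfl⟩ := (X_prime (i := 0)).pow_dvd_of_dvd_mul_left s hX0 ⟨f, hc.symm⟩
  refine Ideal.mem_span_singleton.mpr ⟨d, ?_⟩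
  apply mul_left_cancel₀ (pow_ne_zero s (X_ne_zero (R := F) (0 : Fin 4)))
  rw [hc]
  ring

/-- Kronecker substitution `(X, X ^ q)` is injective on polynomials of degree `< q` in the first
variable. -/
theorem aeval_X_X_pow_ne_zero {K : Type*} [Field K] {q : ℕ} {G : MvPolynomial (Fin 2) K}
    (hG : G ≠ 0) (h0 : G.degreeOf 0 < q) :
    aeval ![(Polynomial.X : Polynomial K), Polynomial.X ^ q] G ≠ 0 := by
  obtain ⟨m, hm⟩ := ne_zero_iff.mp hG
  have hmem : m ∈ G.support := mem_support_iff.mpr hm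
  intro hzero
  have hco := congrArg (fun P : Polynomial K => P.coeff (m 0 + q * m 1)) hzero
  rw [aeval_def, eval₂_eq'] at hco
  simp only [Fin.prod_univ_two, Matrix.cons_val_zero, Matrix.cons_val_one, ← pow_mul, ← pow_add,
    Polynomial.algebraMap_eq, Polynomial.finsetSum_coeff, Polynomial.coeff_C_mul_X_pow,
    Polynomial.coeff_zero] at hco
  rw [Finset.sum_eq_single_of_mem m hmem, if_pos rfl] at hco
  · exact hm hco
  · intro m' hm' hne
    refine if_neg fun heq => hne ?_
    have hm0 := (monomial_le_degreeOf 0 hmem).trans_lt h0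
    have hm0' := (monomial_le_degreeOf 0 hm').trans_lt h0
    have hq : 0 < q := by omega
    have e0 := congrArg (· % q) heq
    have e1 := congrArg (· / q) heq
    simp only [Nat.add_mul_mod_self_left, Nat.mod_eq_of_lt hm0, Nat.mod_eq_of_lt hm0',
      Nat.add_mul_div_left _ _ hq, Nat.div_eq_of_lt hm0, Nat.div_eq_of_lt hm0', zero_add] at e0 e1
    ext i
    fin_cases i
    · exact e0.symm
    · exact e1.symm

theorem exists_root_pow_ne {F K : Type*} [Field F] [Fintype F] [Field K] [IsAlgClosed K]
    [Algebra F K] (t n : F) (hirr : ∀ u v : F, u ^ 2 + t * u * v + n * v ^ 2 = 0 → u = 0 ∧ v = 0) :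
    ∃ α : K, α ^ Fintype.card F ≠ α ∧ α + α ^ Fintype.card F = algebraMap F K t ∧
      α * α ^ Fintype.card F = algebraMap F K n := by
  obtain ⟨α, hα⟩ := IsAlgClosed.exists_root
    (Polynomial.C 1 * Polynomial.X ^ 2 + Polynomial.C (-algebraMap F K t) * Polynomial.X +
      Polynomial.C (algebraMap F K n))
    (by rw [Polynomial.degree_quadratic one_ne_zero]; decide)
  have hα' : α ^ 2 - algebraMap F K t * α + algebraMap F K n = 0 := by
    simpa [Polynomial.IsRoot, sub_eq_add_neg] using hα
  have hβ := congrArg (FiniteField.frobeniusAlgHom F K) hα'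
  simp only [map_add, map_sub, map_mul, map_pow, map_zero, AlgHom.commutes] at hβ
  rw [FiniteField.coe_frobeniusAlgHom] at hβ
  have hne : α ^ Fintype.card F ≠ α := by
    intro hfix
    obtain ⟨a, rfl⟩ : ∃ a, algebraMap F K a = α := by
      have hroot : α ∈ ((Polynomial.X ^ Fintype.card F - Polynomial.X : Polynomial F).map
          (algebraMap F K)).roots := by
        rw [Polynomial.mem_roots (Polynomial.map_ne_zero
          (FiniteField.X_pow_card_sub_X_ne_zero F Fintype.one_lt_card))]
        simp [hfix]
      have hs : Polynomial.Splits (Polynomial.X ^ Fintype.card F - Polynomial.X : Polynomial F) := by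
        rw [Polynomial.splits_iff_card_roots]
        rw [FiniteField.roots_X_pow_card_sub_X,
          FiniteField.X_pow_card_sub_X_natDegree_eq F Fintype.one_lt_card]
        rfl
      rw [hs.roots_map] at hroot
      obtain ⟨a, -, ha⟩ := Multiset.mem_map.mp hroot
      exact ⟨a, ha⟩
    have ha : a ^ 2 - t * a + n = 0 := by
      apply (algebraMap F K).injective
      simpa using hα'
    exact one_ne_zero (neg_eq_zero.mp (hirr a (-1) (by linear_combination ha)).2)
  have hsum : α + α ^ Fintype.card F = algebraMap F K t := by
    apply mul_left_cancel₀ (sub_ne_zero.mpr hne)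
    linear_combination hβ - hα'
  exact ⟨α, hne, hsum, by rw [← hsum] at hα'; linear_combination -hα'⟩

/-- The point `(1, u, v, zw)` with `u + α v = z` and `u + β v = w`. -/
noncomputable def point {K R : Type*} [Field K] [CommRing R] [Algebra K R] (α β : K) (z w : R) :
    Fin 4 → R :=
  ![1, algebraMap K R (β - α)⁻¹ * (algebraMap K R β * z - algebraMap K R α * w),
    algebraMap K R (β - α)⁻¹ * (w - z), z * w]

theorem map_point {K R S : Type*} [Field K] [CommRing R] [Algebra K R] [CommRing S] [Algebra K S]
    (φ : R →ₐ[K] S) (α β : K) (z w : R) :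
    (fun i => φ (point α β z w i)) = point α β (φ z) (φ w) := by
  funext i
  fin_cases i <;> simp [point]

theorem point_add {K : Type*} [Field K] {α β : K} (h : β ≠ α) (u v : K) :
    point α β (u + α * v) (u + β * v) = ![1, u, v, u ^ 2 + (α + β) * u * v + α * β * v ^ 2] := by
  have h' := sub_ne_zero.mpr h
  funext i
  fin_cases i
  · rfl
  · simp [point]
    field_simp
    ring
  · simp [point]
    field_simp
  · simp [point]
    ring

section Restrict

variable {F K : Type*} [Field F] [Field K] [Algebra F K]

theorem degreeOf_aeval_point_le (α β : K) {s : ℕ} {f : MvPolynomial (Fin 4) F}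
    (hf : f.IsHomogeneous s) (i : Fin 2) :
    (aeval (point α β (X 0 : MvPolynomial (Fin 2) K) (X 1)) f).degreeOf i ≤ s := by
  have hX : ∀ j : Fin 2, (X j : MvPolynomial (Fin 2) K).degreeOf i ≤ 1 := fun j => by
    rw [degreeOf_X]; split_ifs <;> omega
  have hp : ∀ k, (point α β (X 0 : MvPolynomial (Fin 2) K) (X 1) k).degreeOf i ≤ 1 := by
    intro k
    fin_cases k
    · simp [point, degreeOf_one]
    · refine (degreeOf_C_mul_le _ _ _).trans ((degreeOf_sub_le _ _ _).trans (max_le ?_ ?_))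
      · exact (degreeOf_C_mul_le _ _ _).trans (hX 0)
      · exact (degreeOf_C_mul_le _ _ _).trans (hX 1)
    · exact (degreeOf_C_mul_le _ _ _).trans
        ((degreeOf_sub_le _ _ _).trans (max_le (hX 1) (hX 0)))
    · refine (degreeOf_mul_le i _ _).trans ?_
      fin_cases i <;> simp [degreeOf_X]
  rw [aeval_def, eval₂_eq]
  refine (degreeOf_sum_le i _ _).trans (Finset.sup_le fun m hm => ?_)
  refine (degreeOf_C_mul_le _ _ _).trans ?_
  refine (degreeOf_prod_le _ _ _).trans ?_
  rw [hf.degree_eq_sum_deg_support hm]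
  refine Finset.sum_le_sum fun k _ => (degreeOf_pow_le _ _ _).trans ?_
  exact (Nat.mul_le_mul_left _ (hp k)).trans_eq (mul_one _)

/-- The restriction of `f` to the affine part of the quadric, as a polynomial in `z = u + α v`. -/
noncomputable def restrict (q : ℕ) (α β : K) (f : MvPolynomial (Fin 4) F) : Polynomial K :=
  aeval (point α β Polynomial.X (Polynomial.X ^ q)) f

theorem eval_restrict (q : ℕ) (α β z : K) (f : MvPolynomial (Fin 4) F) :
    (restrict q α β f).eval z = aeval (point α β z (z ^ q)) f := by
  have h := comp_aeval_apply (point α β (Polynomial.X : Polynomial K) (Polynomial.X ^ q))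
    ((Polynomial.aeval z).restrictScalars F) f
  have hp := map_point (Polynomial.aeval z) α β (Polynomial.X : Polynomial K) (Polynomial.X ^ q)
  simp only [map_pow, Polynomial.aeval_X] at hp
  rw [← hp, restrict, ← Polynomial.coe_aeval_eq_eval]
  exact h

theorem restrict_ne_zero [Infinite K] {t n : F} {q s : ℕ} (hs : s < q) {α β : K} (hne : β ≠ α)
    (hsum : α + β = algebraMap F K t) (hmul : α * β = algebraMap F K n)
    {f : MvPolynomial (Fin 4) F} (hf : f.IsHomogeneous s)
    (hnc : f ∉ Ideal.span {(X 0 * X 3 -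
      (X 1 ^ 2 + C t * X 1 * X 2 + C n * X 2 ^ 2) : MvPolynomial (Fin 4) F)}) :
    restrict q α β f ≠ 0 := by
  have hG : aeval (point α β (X 0 : MvPolynomial (Fin 2) K) (X 1)) f ≠ 0 := by
    refine fun hG => hnc (mem_span_of_aeval_eq_zero (K := K) t n hf fun u v => ?_)
    rw [← hsum, ← hmul, ← point_add hne]
    have hp := map_point (aeval ![u + α * v, u + β * v]) α β (X 0 : MvPolynomial (Fin 2) K) (X 1)
    simp only [aeval_X, Matrix.cons_val_zero, Matrix.cons_val_one] at hp
    have h := comp_aeval_apply (point α β (X 0 : MvPolynomial (Fin 2) K) (X 1))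
      ((aeval ![u + α * v, u + β * v]).restrictScalars F) f
    rw [hG, map_zero] at h
    rw [← hp]
    exact h.symm
  have h := aeval_X_X_pow_ne_zero hG ((degreeOf_aeval_point_le α β hf 0).trans_lt hs)
  have hp := map_point (aeval ![(Polynomial.X : Polynomial K), Polynomial.X ^ q]) α β
    (X 0 : MvPolynomial (Fin 2) K) (X 1)
  simp only [aeval_X, Matrix.cons_val_zero, Matrix.cons_val_one] at hp
  rw [restrict, ← hp]
  exact (comp_aeval_apply (point α β (X 0 : MvPolynomial (Fin 2) K) (X 1))
    ((aeval ![(Polynomial.X : Polynomial K), Polynomial.X ^ q]).restrictScalars F) f).symm ▸ h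

theorem natDegree_restrict_term_le {q : ℕ} (hq : 0 < q) (α β : K) (a : F) (m : Fin 4 →₀ ℕ) :
    (algebraMap F (Polynomial K) a *
      ∏ i, point α β (Polynomial.X : Polynomial K) (Polynomial.X ^ q) i ^ m i).natDegree ≤
      q * (m 1 + m 2) + (q + 1) * m 3 := by
  have hX : (Polynomial.X : Polynomial K).natDegree ≤ q := Polynomial.natDegree_X_le.trans hq
  have hXq : (Polynomial.X ^ q : Polynomial K).natDegree ≤ q := Polynomial.natDegree_X_pow_le q
  have h1 : (point α β (Polynomial.X : Polynomial K) (Polynomial.X ^ q) 1).natDegree ≤ q :=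
    (Polynomial.natDegree_C_mul_le _ _).trans ((Polynomial.natDegree_sub_le_of_le
      ((Polynomial.natDegree_C_mul_le _ _).trans hX)
      ((Polynomial.natDegree_C_mul_le _ _).trans hXq)).trans_eq (max_self q))
  have h2 : (point α β (Polynomial.X : Polynomial K) (Polynomial.X ^ q) 2).natDegree ≤ q :=
    (Polynomial.natDegree_C_mul_le _ _).trans
      ((Polynomial.natDegree_sub_le_of_le hXq hX).trans_eq (max_self q))
  have h3 : (point α β (Polynomial.X : Polynomial K) (Polynomial.X ^ q) 3).natDegree ≤ q + 1 := by
    simp [point, ← pow_succ']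
  have h0 : point α β (Polynomial.X : Polynomial K) (Polynomial.X ^ q) 0 = 1 := rfl
  refine (Polynomial.natDegree_C_mul_le _ _).trans ?_
  rw [Fin.prod_univ_four, h0, one_pow, one_mul]
  refine (Polynomial.natDegree_mul_le_of_le (Polynomial.natDegree_mul_le_of_le
    (Polynomial.natDegree_pow_le_of_le _ h1) (Polynomial.natDegree_pow_le_of_le _ h2))
    (Polynomial.natDegree_pow_le_of_le _ h3)).trans (le_of_eq ?_)
  ring

theorem eq_sum_of_mem_support {s : ℕ} {f : MvPolynomial (Fin 4) F} (hf : f.IsHomogeneous s)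
    {m : Fin 4 →₀ ℕ} (hm : m ∈ f.support) : s = m 0 + m 1 + m 2 + m 3 := by
  rw [← Fin.sum_univ_four (fun i => m i), ← Finsupp.degree_eq_sum]
  exact hf.degree_eq_sum_deg_support hm

theorem natDegree_restrict_le {q s : ℕ} (hq : 0 < q) (α β : K) {f : MvPolynomial (Fin 4) F}
    (hf : f.IsHomogeneous s) : (restrict q α β f).natDegree ≤ s * (q + 1) := by
  rw [restrict, aeval_def, eval₂_eq']
  refine Polynomial.natDegree_sum_le_of_forall_le _ _ fun m hm =>
    (natDegree_restrict_term_le hq α β _ m).trans ?_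
  rw [eq_sum_of_mem_support hf hm]
  nlinarith

theorem natDegree_restrict_lt {q s : ℕ} (hq : 0 < q) {α β : K} {f : MvPolynomial (Fin 4) F}
    (hf : f.IsHomogeneous s) (hne : restrict q α β f ≠ 0) (h : eval ![0, 0, 0, 1] f = 0) :
    (restrict q α β f).natDegree < s * (q + 1) := by
  have hcoeff : coeff (Finsupp.single 3 s) f = 0 := by
    rw [eval_eq'] at h
    by_contra hc
    have hmem : Finsupp.single 3 s ∈ f.support := mem_support_iff.mpr hc
    rw [Finset.sum_eq_single_of_mem _ hmem] at h
    · simp [Fin.prod_univ_four] at h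
      exact hc h
    · intro m hm hms
      rw [mul_eq_zero]
      right
      by_contra hprod
      simp [Fin.prod_univ_four] at hprod
      refine hms ?_
      have hd := eq_sum_of_mem_support hf hm
      ext i
      fin_cases i <;> simp <;> omega
  rw [Polynomial.natDegree_lt_iff_degree_lt hne, restrict, aeval_def, eval₂_eq']
  refine (Polynomial.degree_sum_le _ _).trans_lt ((Finset.sup_lt_iff (WithBot.bot_lt_coe _)).mpr
    fun m hm => Polynomial.degree_le_natDegree.trans_lt (Nat.cast_lt.mpr
      ((natDegree_restrict_term_le hq α β _ m).trans_lt ?_)))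
  have hd := eq_sum_of_mem_support hf hm
  have hlt : 0 < m 0 + m 1 + m 2 := by
    by_contra hle
    refine mem_support_iff.mp hm ?_
    rw [← hcoeff]
    congr 1
    ext i
    fin_cases i <;> simp <;> omega
  rw [hd]
  nlinarith

end Restrict

end EllipticQuadric


open MvPolynomial in
/-- For `s < q-1`, a curve cut out on the elliptic quadric `E : x₀x₃ = Q(x₁,x₂)`
over `F_q` by a surface of degree `s` not containing `E` has at most `s(q+1)`
rational points. -/
theorem stmt_15 (F : Type) [Field F] [Fintype F] (q s : ℕ)
    (hqF : Fintype.card F = q) (hs : s + 1 < q)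
    (t n : F)
    -- Q(x,y) = x² + t·x·y + n·y² is irreducible (anisotropic) over F_q
    (hirr : ∀ u v : F, u ^ 2 + t * u * v + n * v ^ 2 = 0 → u = 0 ∧ v = 0)
    (f : MvPolynomial (Fin 4) F) (hf : f.IsHomogeneous s)
    (hnc : f ∉ Ideal.span {(X 0 * X 3 -
      (X 1 ^ 2 + C t * X 1 * X 2 + C n * X 2 ^ 2) : MvPolynomial (Fin 4) F)}) :
    {p : Fin 4 → F | (∃ i, p i = 1 ∧ ∀ j < i, p j = 0) ∧
        p 0 * p 3 = p 1 ^ 2 + t * p 1 * p 2 + n * p 2 ^ 2 ∧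
        MvPolynomial.eval p f = 0}.ncard ≤ s * (q + 1) := by
  subst hqF
  set q := Fintype.card F
  let K := AlgebraicClosure F
  have hq : 0 < q := Fintype.card_pos
  obtain ⟨α, hne, hsum, hmul⟩ := EllipticQuadric.exists_root_pow_ne (K := K) t n hirr
  set P := EllipticQuadric.restrict q α (α ^ q) f with hP
  have hP0 : P ≠ 0 := EllipticQuadric.restrict_ne_zero (by omega) hne hsum hmul hf hnc
  set A : Set (Fin 4 → F) := {p | p 0 = 1 ∧
    p 0 * p 3 = p 1 ^ 2 + t * p 1 * p 2 + n * p 2 ^ 2 ∧ eval p f = 0}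
  let φ : (Fin 4 → F) → K := fun p => algebraMap F K (p 1) + α * algebraMap F K (p 2)
  have hpow : ∀ p, φ p ^ q = algebraMap F K (p 1) + α ^ q * algebraMap F K (p 2) := fun p => by
    have h := map_add (FiniteField.frobeniusAlgHom F K) (algebraMap F K (p 1))
      (α * algebraMap F K (p 2))
    rw [map_mul, AlgHom.commutes, AlgHom.commutes] at h
    exact h
  have hpoint : ∀ p ∈ A, EllipticQuadric.point α (α ^ q) (φ p) (φ p ^ q) =
      fun i => algebraMap F K (p i) := by
    rintro p ⟨hp0, hpQ, -⟩
    rw [hpow, EllipticQuadric.point_add hne, hsum, hmul]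
    rw [hp0, one_mul] at hpQ
    funext i
    fin_cases i <;> simp [hp0, hpQ]
  have hcard : A.ncard ≤ P.natDegree := by
    classical
    refine le_trans ?_ ((Multiset.toFinset_card_le _).trans P.card_roots')
    rw [← Set.ncard_coe_finset]
    refine Set.ncard_le_ncard_of_injOn φ (fun p hp => ?_) (fun p hp p' hp' h => ?_)
      (Finset.finite_toSet _)
    · rw [Finset.mem_coe, Multiset.mem_toFinset, Polynomial.mem_roots hP0, Polynomial.IsRoot,
        hP, EllipticQuadric.eval_restrict, hpoint p hp]
      change aeval (algebraMap F K ∘ p) f = 0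
      rw [aeval_algebraMap_apply, aeval_eq_eval]
      exact (congrArg (algebraMap F K) hp.2.2).trans (map_zero _)
    · funext i
      apply (algebraMap F K).injective
      have := (hpoint p hp).symm.trans ((congrArg
        (fun z => EllipticQuadric.point α (α ^ q) z (z ^ q)) h).trans (hpoint p' hp'))
      exact congrFun this i
  have hsub : ∀ p : Fin 4 → F, (∃ i, p i = 1 ∧ ∀ j < i, p j = 0) →
      p 0 * p 3 = p 1 ^ 2 + t * p 1 * p 2 + n * p 2 ^ 2 → p 0 = 1 ∨ p = ![0, 0, 0, 1] := by
    rintro p ⟨i, hi, hj⟩ hpQ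
    by_cases h0 : p 0 = 0
    · right
      rw [h0, zero_mul] at hpQ
      obtain ⟨h1, h2⟩ := hirr _ _ hpQ.symm
      have h3 : p 3 = 1 := by
        fin_cases i
        · exact absurd (h0.symm.trans hi) zero_ne_one
        · exact absurd (h1.symm.trans hi) zero_ne_one
        · exact absurd (h2.symm.trans hi) zero_ne_one
        · exact hi
      funext k
      fin_cases k <;> simp [h0, h1, h2, h3]
    · left
      rcases eq_or_ne i 0 with rfl | hi0
      · exact hi
      · exact absurd (hj 0 (Fin.pos_of_ne_zero hi0)) h0
  by_cases hinf : eval ![0, 0, 0, 1] f = 0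
  · have hlt : P.natDegree < s * (q + 1) := EllipticQuadric.natDegree_restrict_lt hq hf hP0 hinf
    refine (Set.ncard_le_ncard (t := insert ![0, 0, 0, 1] A) ?_ (Set.toFinite _)).trans
      ((Set.ncard_insert_le _ _).trans (by omega))
    rintro p ⟨hp, hpQ, hpf⟩
    rcases hsub p hp hpQ with h | h
    · exact Or.inr ⟨h, hpQ, hpf⟩
    · exact Or.inl h
  · refine (Set.ncard_le_ncard (t := A) ?_ (Set.toFinite _)).trans
      (hcard.trans (EllipticQuadric.natDegree_restrict_le hq α (α ^ q) hf))
    rintro p ⟨hp, hpQ, hpf⟩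
    rcases hsub p hp hpQ with h | rfl
    · exact ⟨h, hpQ, hpf⟩
    · exact absurd hpf hinf
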